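/- arXiv:1006.2617 — 3 statements merged into one kernel-verified Lean document; each statement's English description precedes it below -/
import Mathlib

section
/- For any ordered set of jobs J scheduled by Gang FJP with a Parallelism Monotonic priority assignment on m identical processors, such that J⁺ is schedulable, the level-i processor availabilities satisfy A_i(J⁺⁽ⁱ⁻¹⁾, t) ≤ A_i(J⁽ⁱ⁻¹⁾, t) for all time instants t and all i (both job sets being ordered in the same decreasing order of priorities). -/
/-- A parallel rigid job `J = (r, v, e, d)`: release time `r`, required number of
processors `v`, execution requirement `e`, absolute deadline `d`. -/
structure Job where
  r : ℕ
  v : ℕ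
  e : ℕ
  d : ℕ

/-- Number of currently free processors in a one-instant processor assignment
(`0` denotes an idle processor). -/
def freeCount {m : ℕ} (σt : Fin m → ℕ) : ℕ :=
  (Finset.univ.filter fun k => σt k = 0).card

/-- Assign the job with identifier `id` to the first `v` free processors. -/
def assignJob {m : ℕ} (σt : Fin m → ℕ) (id v : ℕ) : Fin m → ℕ := fun k =>
  if σt k = 0 ∧ (Finset.univ.filter fun k' => σt k' = 0 ∧ k' < k).card < v then id
  else σt k

/-- One scheduling pass of the (limited or not) Gang scheduler over the
priority-ordered list of active jobs, given as pairs `(id, v)`: the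
highest-priority active job is placed on the first `v` available processors if at
least `v` are available; otherwise it is skipped and the same rule is applied to
the remaining jobs (non-limited variant, `limited = false`), or the pass stops at
this first job that cannot be scheduled (limited variant, `limited = true`). -/
def gangPass (m : ℕ) (limited : Bool) : List (ℕ × ℕ) → (Fin m → ℕ) → (Fin m → ℕ)
  | [], σt => σt
  | (id, v) :: rest, σt =>
    if v ≤ freeCount σt then gangPass m limited rest (assignJob σt id v)
    else if limited then σt
    else gangPass m limited rest σt

/-- The priority-ordered list `(i+1, vᵢ)` of jobs among the `p` highest-priority
jobs of `J` that are active at time `t` (released, remaining work not exhausted). -/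
def activeJobs (J : ℕ → Job) (p t : ℕ) (rem : ℕ → ℕ) : List (ℕ × ℕ) :=
  ((List.range p).filter fun i => decide ((J i).r ≤ t ∧ rem i ≠ 0)).map fun i =>
    (i + 1, (J i).v)

/-- Remaining execution requirement of job `i` at the start of slot `t` in the
Gang FJP schedule of the `p` highest-priority jobs `J⁽ᵖ⁾ = {J₀, …, J_{p-1}}` on
`m` identical processors (`J₀ > J₁ > ⋯` is the decreasing priority order). -/
def remWork (m : ℕ) (J : ℕ → Job) (limited : Bool) (p : ℕ) : ℕ → ℕ → ℕ
  | 0, i => (J i).e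
  | t + 1, i =>
    let σt := gangPass m limited (activeJobs J p t (remWork m J limited p t)) fun _ => 0
    if ∃ k : Fin m, σt k = i + 1 then remWork m J limited p t i - 1
    else remWork m J limited p t i

/-- The schedule `σ(t)`: `schedAt m J limited p t k = i + 1` iff job `Jᵢ` occupies
processor `π_k` at time `t`, and `= 0` iff `π_k` is idle. -/
def schedAt (m : ℕ) (J : ℕ → Job) (limited : Bool) (p t : ℕ) : Fin m → ℕ :=
  gangPass m limited (activeJobs J p t (remWork m J limited p t)) fun _ => 0

/-- `S(J⁽ᵖ⁾)` for `p = i+1`: the time at which job `Jᵢ` begins its execution in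
the schedule of the `p` highest-priority jobs. -/
noncomputable def startTime (m : ℕ) (J : ℕ → Job) (limited : Bool) (p i : ℕ) : ℕ :=
  sInf {t | ∃ k : Fin m, schedAt m J limited p t k = i + 1}

/-- `F(J⁽ᵖ⁾)` for `p = i+1`: the time at which job `Jᵢ` completes its execution in
the schedule of the `p` highest-priority jobs. -/
noncomputable def finishTime (m : ℕ) (J : ℕ → Job) (limited : Bool) (p i : ℕ) : ℕ :=
  sInf {t | remWork m J limited p t i = 0}

/-- The set of the `p` highest-priority jobs of `J` is schedulable if each of these
jobs completes by its deadline. -/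
def Schedulable (m : ℕ) (J : ℕ → Job) (limited : Bool) (p : ℕ) : Prop :=
  ∀ i < p, remWork m J limited p ((J i).d) i = 0

/-- `#A(J⁽ᵖ⁾,t)`: the number of available processors at time `t` in the schedule
of the `p` highest-priority jobs of `J`. -/
def availCount (m : ℕ) (J : ℕ → Job) (limited : Bool) (p t : ℕ) : ℕ :=
  (Finset.univ.filter fun k : Fin m => schedAt m J limited p t k = 0).card


/-- Level-`i` availability of the processors `A_i(J,t)` for a job requiring `w`
processors: the number `#A(J⁽ᵖ⁾,t)` of available processors if it is at least `w`,
and `0` otherwise. -/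
def levelAvail (m : ℕ) (J : ℕ → Job) (limited : Bool) (p w t : ℕ) : ℕ :=
  if w ≤ availCount m J limited p t then availCount m J limited p t else 0

theorem Finset.card_filter_rank_lt {α : Type*} [LinearOrder α] (s : Finset α) (v : ℕ) :
    (s.filter fun k => (s.filter fun k' => k' < k).card < v).card = min v s.card := by
  induction s using Finset.induction_on_max with
  | empty => simp
  | insert a s ha ih =>
    have hna : a ∉ s := fun h => lt_irrefl a (ha a h)
    have hrank_a : (insert a s).filter (fun k' => k' < a) = s := by
      ext x
      simp only [Finset.mem_filter, Finset.mem_insert]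
      grind
    have hrank : ∀ k ∈ s, (insert a s).filter (fun k' => k' < k) = s.filter (fun k' => k' < k) := by
      intro k hk
      rw [Finset.filter_insert, if_neg (ha k hk).le.not_gt]
    have hs : (s.filter fun k => ((insert a s).filter fun k' => k' < k).card < v) =
        s.filter fun k => (s.filter fun k' => k' < k).card < v :=
      Finset.filter_congr fun k hk => by rw [hrank k hk]
    rw [Finset.filter_insert, hrank_a, hs, Finset.card_insert_of_notMem hna]
    split_ifs with h
    · rw [Finset.card_insert_of_notMem (by simp [hna]), ih]
      omega
    · rw [ih]
      omega

theorem card_newly_assigned {m : ℕ} (σt : Fin m → ℕ) (v : ℕ) :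
    (Finset.univ.filter fun k => σt k = 0 ∧
      (Finset.univ.filter fun k' => σt k' = 0 ∧ k' < k).card < v).card =
      min v (freeCount σt) := by
  have h := Finset.card_filter_rank_lt (Finset.univ.filter fun k => σt k = 0) v
  simpa only [Finset.filter_filter, freeCount] using h

theorem freeCount_assignJob {m : ℕ} (σt : Fin m → ℕ) {id v : ℕ} (hid : id ≠ 0) :
    freeCount (assignJob σt id v) = freeCount σt - v := by
  have hsplit := Finset.card_filter_add_card_filter_not
    (s := Finset.univ.filter fun k => σt k = 0)
    (fun k => (Finset.univ.filter fun k' => σt k' = 0 ∧ k' < k).card < v)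
  simp only [Finset.filter_filter] at hsplit
  rw [card_newly_assigned] at hsplit
  have hfree : freeCount (assignJob σt id v) = (Finset.univ.filter fun k => σt k = 0 ∧
      ¬ (Finset.univ.filter fun k' => σt k' = 0 ∧ k' < k).card < v).card := by
    unfold freeCount
    congr 1
    refine Finset.filter_congr fun k _ => ?_
    unfold assignJob
    split_ifs with h
    · simp [hid, h.2]
    · tauto
  unfold freeCount at hsplit hfree ⊢
  omega

theorem exists_assignJob_eq_id {m : ℕ} (σt : Fin m → ℕ) (id : ℕ) {v : ℕ} (hv : 1 ≤ v)
    (hfree : v ≤ freeCount σt) : ∃ k, assignJob σt id v k = id := by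
  have hcard := card_newly_assigned σt v
  obtain ⟨k, hk⟩ := Finset.card_pos.mp (by omega : 0 < (Finset.univ.filter fun k => σt k = 0 ∧
    (Finset.univ.filter fun k' => σt k' = 0 ∧ k' < k).card < v).card)
  exact ⟨k, if_pos (Finset.mem_filter.mp hk).2⟩

theorem assignJob_eq_iff {m : ℕ} (σt : Fin m → ℕ) {id v n : ℕ} (hn : n ≠ 0) (hid : id ≠ n)
    (k : Fin m) : assignJob σt id v k = n ↔ σt k = n := by
  unfold assignJob
  grind

theorem gangPass_append (m : ℕ) (l₁ l₂ : List (ℕ × ℕ)) (σt : Fin m → ℕ) :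
    gangPass m false (l₁ ++ l₂) σt = gangPass m false l₂ (gangPass m false l₁ σt) := by
  induction l₁ generalizing σt with
  | nil => rfl
  | cons x l ih =>
    obtain ⟨id, v⟩ := x
    simp only [List.cons_append, gangPass, Bool.false_eq_true, if_false]
    split_ifs <;> exact ih _

theorem activeJobs_congr {J : ℕ → Job} {p t : ℕ} {rem rem' : ℕ → ℕ}
    (h : ∀ i < p, rem i = rem' i) : activeJobs J p t rem = activeJobs J p t rem' := by
  unfold activeJobs
  congr 1
  refine List.filter_congr fun i hi => ?_
  rw [h i (List.mem_range.mp hi)]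

theorem activeJobs_succ (J : ℕ → Job) (p t : ℕ) (rem : ℕ → ℕ) :
    activeJobs J (p + 1) t rem = activeJobs J p t rem ++
      if (J p).r ≤ t ∧ rem p ≠ 0 then [(p + 1, (J p).v)] else [] := by
  unfold activeJobs
  rw [List.range_succ, List.filter_append, List.map_append]
  congr 1
  split_ifs with h <;> simp [h]

theorem gangPass_activeJobs_succ (m : ℕ) (J : ℕ → Job) (p t : ℕ) (rem : ℕ → ℕ)
    (σt : Fin m → ℕ) :
    gangPass m false (activeJobs J (p + 1) t rem) σt =
      if ((J p).r ≤ t ∧ rem p ≠ 0) ∧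
          (J p).v ≤ freeCount (gangPass m false (activeJobs J p t rem) σt) then
        assignJob (gangPass m false (activeJobs J p t rem) σt) (p + 1) (J p).v
      else gangPass m false (activeJobs J p t rem) σt := by
  rw [activeJobs_succ, gangPass_append]
  by_cases h : (J p).r ≤ t ∧ rem p ≠ 0 <;> simp [h, gangPass]

theorem gangPass_activeJobs_le (m : ℕ) (J : ℕ → Job) (p t : ℕ) (rem : ℕ → ℕ) (k : Fin m) :
    gangPass m false (activeJobs J p t rem) (fun _ => 0) k ≤ p := by
  induction p with
  | zero => simp [activeJobs, gangPass]
  | succ p ih =>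
    rw [gangPass_activeJobs_succ]
    unfold assignJob
    split_ifs <;> grind

theorem remWork_succ_prefix (m : ℕ) (J : ℕ → Job) (p t : ℕ) :
    ∀ i < p, remWork m J false (p + 1) t i = remWork m J false p t i := by
  induction t with
  | zero => intro i _; rfl
  | succ t ih =>
    intro i hi
    simp only [remWork]
    rw [ih i hi, gangPass_activeJobs_succ, activeJobs_congr ih]
    have hiff : ∀ σt : Fin m → ℕ, ∀ v, (∃ k, assignJob σt (p + 1) v k = i + 1) ↔
        ∃ k, σt k = i + 1 := fun σt v =>
      exists_congr fun k => assignJob_eq_iff σt (by omega) (by omega) k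
    congr 1
    split_ifs <;> simp only [hiff]

theorem schedAt_succ (m : ℕ) (J : ℕ → Job) (p t : ℕ) :
    schedAt m J false (p + 1) t =
      if ((J p).r ≤ t ∧ remWork m J false (p + 1) t p ≠ 0) ∧
          (J p).v ≤ availCount m J false p t then
        assignJob (schedAt m J false p t) (p + 1) (J p).v
      else schedAt m J false p t := by
  have h : activeJobs J p t (remWork m J false (p + 1) t) =
      activeJobs J p t (remWork m J false p t) :=
    activeJobs_congr (remWork_succ_prefix m J p t)
  unfold schedAt
  rw [gangPass_activeJobs_succ, h]
  rfl

theorem availCount_succ (m : ℕ) (J : ℕ → Job) (p t : ℕ) :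
    availCount m J false (p + 1) t =
      if ((J p).r ≤ t ∧ remWork m J false (p + 1) t p ≠ 0) ∧
          (J p).v ≤ availCount m J false p t then
        availCount m J false p t - (J p).v
      else availCount m J false p t := by
  change freeCount (schedAt m J false (p + 1) t) = _
  rw [schedAt_succ]
  split_ifs
  · exact freeCount_assignJob _ (Nat.succ_ne_zero p)
  · rfl

theorem exists_schedAt_last_iff (m : ℕ) (J : ℕ → Job) (p t : ℕ) (hv : 1 ≤ (J p).v) :
    (∃ k, schedAt m J false (p + 1) t k = p + 1) ↔
      ((J p).r ≤ t ∧ remWork m J false (p + 1) t p ≠ 0) ∧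
        (J p).v ≤ availCount m J false p t := by
  rw [schedAt_succ]
  split_ifs with h
  · exact iff_of_true (exists_assignJob_eq_id _ _ hv h.2) h
  · refine iff_of_false ?_ h
    rintro ⟨k, hk⟩
    have hle : schedAt m J false p t k ≤ p := gangPass_activeJobs_le m J p t _ k
    omega

theorem remWork_last_succ (m : ℕ) (J : ℕ → Job) (p t : ℕ) (hv : 1 ≤ (J p).v) :
    remWork m J false (p + 1) (t + 1) p =
      if ((J p).r ≤ t ∧ remWork m J false (p + 1) t p ≠ 0) ∧
          (J p).v ≤ availCount m J false p t then
        remWork m J false (p + 1) t p - 1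
      else remWork m J false (p + 1) t p := by
  simp only [← exists_schedAt_last_iff m J p t hv]
  rfl

theorem levelAvail_le_iff {m : ℕ} {J J' : ℕ → Job} {p w t : ℕ} :
    levelAvail m J false p w t ≤ levelAvail m J' false p w t ↔
      (w ≤ availCount m J false p t → availCount m J false p t ≤ availCount m J' false p t) := by
  unfold levelAvail
  split_ifs <;> omega

theorem remWork_last_le {m : ℕ} {J J' : ℕ → Job} {p : ℕ} (hr : (J' p).r = (J p).r)
    (hv : (J' p).v = (J p).v) (he : (J p).e ≤ (J' p).e) (hv1 : 1 ≤ (J p).v)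
    (havail : ∀ t, (J p).v ≤ availCount m J' false p t →
      availCount m J' false p t ≤ availCount m J false p t) (t : ℕ) :
    remWork m J false (p + 1) t p ≤ remWork m J' false (p + 1) t p := by
  induction t with
  | zero => exact he
  | succ t ih =>
    rw [remWork_last_succ m J p t hv1, remWork_last_succ m J' p t (hv ▸ hv1), hr, hv]
    have := havail t
    split_ifs <;> omega

/-- **Lemma 2 (level-`i` availability, Parallelism Monotonic).**
Let `J` be an ordered set of jobs (0-indexed, decreasing priorities) with actual
execution times `eᵢ ≤ eᵢ⁺`, and `J⁺` the corresponding worst-case jobs (same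
release times, processor requirements and deadlines). If the priority assignment
is Parallelism Monotonic (`i ≤ j → vᵢ ≤ v_j`) and `J⁺` is schedulable by Gang FJP
on `m` identical processors, then `A_i(J⁺⁽ⁱ⁻¹⁾, t) ≤ A_i(J⁽ⁱ⁻¹⁾, t)` for all `t`
and all `i` (0-indexed: the prefix of the `i` jobs of higher priority than job `i`,
and level width `vᵢ`). -/
theorem gang_fjp_parallelism_monotonic_level_avail
    (m : ℕ) (J Jplus : ℕ → Job)
    (hr : ∀ i, (Jplus i).r = (J i).r)
    (hv : ∀ i, (Jplus i).v = (J i).v)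
    (hd : ∀ i, (Jplus i).d = (J i).d)
    (he : ∀ i, (J i).e ≤ (Jplus i).e)
    (hv1 : ∀ i, 1 ≤ (J i).v)
    (hmono : ∀ i j, i ≤ j → (J i).v ≤ (J j).v)
    (hsched : ∀ p, Schedulable m Jplus false p) :
    ∀ i t, levelAvail m Jplus false i ((J i).v) t ≤ levelAvail m J false i ((J i).v) t := by
  simp only [levelAvail_le_iff]
  intro i
  induction i with
  | zero =>
    intro t _
    simp [availCount, schedAt, activeJobs, gangPass]
  | succ i ih =>
    intro t hw
    have hrem := remWork_last_le (hr i) (hv i) (he i) (hv1 i) ih t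
    have hstep := ih t
    have hvi := hmono i (i + 1) (Nat.le_succ i)
    rw [availCount_succ, hr, hv] at hw ⊢
    rw [availCount_succ]
    split_ifs at hw ⊢ <;> omega
end

section
/- For any ordered set of jobs J scheduled by the Limited Gang FJP scheduler on m identical processors, such that J⁺ is schedulable, the limited level-i processor availabilities satisfy Â_i(J⁺⁽ⁱ⁻¹⁾, t) ≤ Â_i(J⁽ⁱ⁻¹⁾, t) for all time instants t and all i (both job sets being ordered in the same decreasing order of priorities). -/
/-- Limited level-`i` availability of the processors `Â_i(J,t)`, given the number
`c = #A(J,t)` of available processors and the processor requirements `v` of the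
jobs (0-indexed: the job of paper-index `i` has width `v (i-1)`):
`Â_0 = m`; `Â_i = 0` if `Â_{i-1} = 0`; `Â_i = #A(J,t)` if `#A(J,t) ≥ vᵢ` and
`Â_{i-1} ≠ 0`; and `Â_i = 0` otherwise. -/
def hatAvail (m : ℕ) (v : ℕ → ℕ) (c : ℕ) : ℕ → ℕ
  | 0 => m
  | i + 1 => if hatAvail m v c i = 0 then 0 else if v i ≤ c then c else 0

theorem card_filter_rank_lt {m : ℕ} (P : Fin m → Prop) [DecidablePred P] {v : ℕ}
    (hv : v ≤ (Finset.univ.filter P).card) :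
    (Finset.univ.filter fun k =>
      P k ∧ (Finset.univ.filter fun k' => P k' ∧ k' < k).card < v).card = v := by
  classical
  set f : Fin m → ℕ := fun k => (Finset.univ.filter fun k' => P k' ∧ k' < k).card with hf
  have hlt : ∀ a b, P a → a < b → f a < f b := by
    intro a b ha hab
    apply Finset.card_lt_card
    rw [Finset.ssubset_iff_of_subset]
    · exact ⟨a, by simp [ha, hab], by simp⟩
    · intro k hk
      simp only [Finset.mem_filter, Finset.mem_univ, true_and] at hk ⊢
      exact ⟨hk.1, hk.2.trans hab⟩
  have hinj : Set.InjOn f {k | P k} := by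
    intro a ha b hb hab
    rcases lt_trichotomy a b with h | h | h
    · exact absurd hab (hlt a b ha h).ne
    · exact h
    · exact absurd hab (hlt b a hb h).ne'
  have himg : (Finset.univ.filter P).image f = Finset.range (Finset.univ.filter P).card := by
    apply Finset.eq_of_subset_of_card_le
    · intro n hn
      obtain ⟨k, hk, rfl⟩ := Finset.mem_image.1 hn
      rw [Finset.mem_range]
      apply Finset.card_lt_card
      rw [Finset.ssubset_iff_of_subset]
      · exact ⟨k, hk, by simp⟩
      · intro k' hk'
        simp only [Finset.mem_filter, Finset.mem_univ, true_and] at hk' ⊢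
        exact hk'.1
    · rw [Finset.card_range, Finset.card_image_of_injOn]
      simpa using hinj
  have himg' : (Finset.univ.filter fun k => P k ∧ f k < v).image f = Finset.range v := by
    ext n
    simp only [Finset.mem_image, Finset.mem_filter, Finset.mem_univ, true_and, Finset.mem_range]
    constructor
    · rintro ⟨k, hk, rfl⟩
      exact hk.2
    · intro hn
      have : n ∈ (Finset.univ.filter P).image f := by
        rw [himg, Finset.mem_range]
        omega
      obtain ⟨k, hk, rfl⟩ := Finset.mem_image.1 this
      exact ⟨k, ⟨(Finset.mem_filter.1 hk).2, hn⟩, rfl⟩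
  rw [← Finset.card_image_of_injOn (f := f), himg', Finset.card_range]
  exact hinj.mono fun k hk => (Finset.mem_filter.1 (Finset.mem_coe.1 hk)).2.1

theorem freeCount_assignJob_add {m : ℕ} (σt : Fin m → ℕ) {id v : ℕ} (hid : id ≠ 0)
    (hv : v ≤ freeCount σt) : freeCount (assignJob σt id v) + v = freeCount σt := by
  have h := card_filter_rank_lt (fun k => σt k = 0) hv
  have hsplit := Finset.card_filter_add_card_filter_not (s := Finset.univ.filter fun k => σt k = 0)
    (fun k => (Finset.univ.filter fun k' => σt k' = 0 ∧ k' < k).card < v)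
  rw [Finset.filter_filter, Finset.filter_filter, h] at hsplit
  unfold freeCount
  rw [← hsplit, add_comm]
  congr 2
  ext k
  rw [Finset.mem_filter, Finset.mem_filter, assignJob]
  simp only [Finset.mem_univ, true_and]
  split_ifs with hk <;> tauto

theorem exists_assignJob_eq {m : ℕ} (σt : Fin m → ℕ) (id : ℕ) {v : ℕ} (hpos : 1 ≤ v)
    (hv : v ≤ freeCount σt) : ∃ k, assignJob σt id v k = id := by
  have h := card_filter_rank_lt (fun k => σt k = 0) hv
  obtain ⟨k, hk⟩ := Finset.card_pos.1 (by rw [h]; exact hpos)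
  exact ⟨k, if_pos (Finset.mem_filter.1 hk).2⟩

theorem assignJob_of_ne_zero {m : ℕ} {σt : Fin m → ℕ} {k : Fin m} (id v : ℕ) (h : σt k ≠ 0) :
    assignJob σt id v k = σt k :=
  if_neg fun h' => h h'.1

theorem gangPass_of_ne_zero {m : ℕ} (L : List (ℕ × ℕ)) :
    ∀ {σt : Fin m → ℕ} {k : Fin m}, σt k ≠ 0 → gangPass m true L σt k = σt k := by
  induction L with
  | nil => intros; rfl
  | cons x L ih =>
    intro σt k h
    simp only [gangPass, if_true]
    split_ifs
    · have h' := assignJob_of_ne_zero x.1 x.2 h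
      rw [ih (h' ▸ h), h']
    · rfl

/-- Total width of the jobs in `L` whose identifier is at most `id`. -/
def widthUpTo (L : List (ℕ × ℕ)) (id : ℕ) : ℕ :=
  ((L.filter fun x => x.1 ≤ id).map Prod.snd).sum

theorem exists_gangPass_eq_iff {m : ℕ} {id : ℕ} (hid : id ≠ 0) (L : List (ℕ × ℕ)) :
    ∀ {σt : Fin m → ℕ}, L.Pairwise (fun x y => x.1 < y.1) → (∀ x ∈ L, x.1 ≠ 0 ∧ 1 ≤ x.2) →
      (∀ k, σt k ≠ id) →
      ((∃ k, gangPass m true L σt k = id) ↔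
        id ∈ L.map Prod.fst ∧ widthUpTo L id ≤ freeCount σt) := by
  induction L with
  | nil => intro σt _ _ h; simpa [gangPass] using h
  | cons x L ih =>
    intro σt hp hL h
    obtain ⟨a, v⟩ := x
    obtain ⟨hlt, hp⟩ := List.pairwise_cons.1 hp
    obtain ⟨⟨ha, hv⟩, hL⟩ := List.forall_mem_cons.1 hL
    simp only at ha hv hlt
    simp only [gangPass, if_true]
    rcases eq_or_ne a id with rfl | hne
    · have hw : widthUpTo ((a, v) :: L) a = v := by
        have : L.filter (fun x => decide (x.1 ≤ a)) = [] := by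
          rw [List.filter_eq_nil_iff]
          intro y hy
          simpa using hlt y hy
        simp [widthUpTo, this]
      rw [hw]
      split_ifs with hfit
      · obtain ⟨k, hk⟩ := exists_assignJob_eq σt a hv hfit
        simp only [List.map_cons, List.mem_cons, true_or, hfit, and_self, iff_true]
        exact ⟨k, by rw [gangPass_of_ne_zero L (by rw [hk]; exact ha), hk]⟩
      · simp [hfit, h]
    · have hmem : id ∈ ((a, v) :: L).map Prod.fst ↔ id ∈ L.map Prod.fst := by
        simp [hne.symm]
      have hw : id ∈ L.map Prod.fst → widthUpTo ((a, v) :: L) id = v + widthUpTo L id := by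
        intro hmem'
        obtain ⟨y, hy, rfl⟩ := List.mem_map.1 hmem'
        simp [widthUpTo, (hlt y hy).le]
      rw [hmem]
      split_ifs with hfit
      · have hfree := freeCount_assignJob_add σt ha hfit
        rw [ih hp hL]
        · refine and_congr_right fun hmem' => ?_
          rw [hw hmem']
          omega
        · intro k
          unfold assignJob
          split_ifs
          · exact hne
          · exact h k
      · refine iff_of_false (by simpa using h) fun ⟨hmem', hle⟩ => ?_
        rw [hw hmem'] at hle
        omega

theorem freeCount_gangPass_add {m : ℕ} (L : List (ℕ × ℕ)) :
    ∀ {σt : Fin m → ℕ}, (∀ x ∈ L, x.1 ≠ 0) → (L.map Prod.snd).sum ≤ freeCount σt →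
      freeCount (gangPass m true L σt) + (L.map Prod.snd).sum = freeCount σt := by
  induction L with
  | nil => intros; simp [gangPass]
  | cons x L ih =>
    intro σt hL hle
    obtain ⟨hx, hL⟩ := List.forall_mem_cons.1 hL
    simp only [List.map_cons, List.sum_cons] at hle ⊢
    have hfit : x.2 ≤ freeCount σt := by omega
    have hfree := freeCount_assignJob_add σt hx hfit
    simp only [gangPass, if_pos hfit]
    have := ih (σt := assignJob σt x.1 x.2) hL (by omega)
    omega

theorem sum_le_freeCount_of_forall_le {m : ℕ} (L : List (ℕ × ℕ)) :
    ∀ {σt : Fin m → ℕ}, (∀ x ∈ L, x.1 ≠ 0) →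
      (∀ x ∈ L, x.2 ≤ freeCount (gangPass m true L σt)) →
      (L.map Prod.snd).sum ≤ freeCount σt := by
  induction L with
  | nil => intros; simp
  | cons x L ih =>
    intro σt hL hle
    obtain ⟨hx, hL⟩ := List.forall_mem_cons.1 hL
    obtain ⟨hxle, hle⟩ := List.forall_mem_cons.1 hle
    by_cases hfit : x.2 ≤ freeCount σt
    · simp only [gangPass, if_pos hfit] at hle
      have hfree := freeCount_assignJob_add σt hx hfit
      have := ih hL hle
      simp only [List.map_cons, List.sum_cons]
      omega
    · simp only [gangPass, if_neg hfit, if_true] at hxle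
      exact absurd hxle hfit

theorem mem_activeJobs {J : ℕ → Job} {p t : ℕ} {rem : ℕ → ℕ} {x : ℕ × ℕ} :
    x ∈ activeJobs J p t rem ↔
      ∃ i < p, ((J i).r ≤ t ∧ rem i ≠ 0) ∧ (i + 1, (J i).v) = x := by
  simp [activeJobs, and_assoc]

theorem succ_mem_map_fst_activeJobs {J : ℕ → Job} {p t : ℕ} {rem : ℕ → ℕ} {i : ℕ} :
    i + 1 ∈ (activeJobs J p t rem).map Prod.fst ↔ i < p ∧ (J i).r ≤ t ∧ rem i ≠ 0 := by
  simp [activeJobs]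

theorem pairwise_activeJobs (J : ℕ → Job) (p t : ℕ) (rem : ℕ → ℕ) :
    (activeJobs J p t rem).Pairwise fun x y => x.1 < y.1 := by
  rw [activeJobs, List.pairwise_map]
  exact (List.pairwise_lt_range.filter _).imp fun h => Nat.succ_lt_succ h

theorem activeJobs_sublist {J J' : ℕ → Job} (hr : ∀ i, (J' i).r = (J i).r)
    (hv : ∀ i, (J' i).v = (J i).v) (p t : ℕ) {rem rem' : ℕ → ℕ} (hrem : ∀ i, rem i ≤ rem' i) :
    (activeJobs J p t rem).Sublist (activeJobs J' p t rem') := by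
  simp only [activeJobs, hr, hv]
  refine (List.monotone_filter_right _ fun i => ?_).map _
  have := hrem i
  simp only [decide_eq_true_eq]
  omega

theorem sum_snd_le_of_sublist {L L' : List (ℕ × ℕ)} (h : L.Sublist L') :
    (L.map Prod.snd).sum ≤ (L'.map Prod.snd).sum :=
  (h.map _).sum_le_sum fun _ _ => Nat.zero_le _

/-- With larger execution requirements, every job has at least as much remaining work. -/
theorem remWork_mono {m : ℕ} {J J' : ℕ → Job} (hr : ∀ i, (J' i).r = (J i).r)
    (hv : ∀ i, (J' i).v = (J i).v) (he : ∀ i, (J i).e ≤ (J' i).e) (hv1 : ∀ i, 1 ≤ (J i).v)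
    (p t : ℕ) : ∀ i, remWork m J true p t i ≤ remWork m J' true p t i := by
  induction t with
  | zero => exact he
  | succ t ih =>
    intro i
    have hsub := activeJobs_sublist hr hv p t ih
    have hrun : ∀ K : ℕ → Job, (∀ i, 1 ≤ (K i).v) → ∀ rem : ℕ → ℕ,
        ((∃ k, gangPass m true (activeJobs K p t rem) (fun _ => 0) k = i + 1) ↔
          i + 1 ∈ (activeJobs K p t rem).map Prod.fst ∧
            widthUpTo (activeJobs K p t rem) (i + 1) ≤ freeCount fun _ : Fin m => 0) := by
      intro K hK rem
      refine exists_gangPass_eq_iff i.succ_ne_zero _ (pairwise_activeJobs ..) ?_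
        fun _ => i.succ_ne_zero.symm
      intro x hx
      obtain ⟨j, -, -, rfl⟩ := mem_activeJobs.1 hx
      exact ⟨j.succ_ne_zero, hK j⟩
    simp only [remWork, hrun J hv1, hrun J' fun i => hv i ▸ hv1 i]
    have hi := ih i
    by_cases h0 : remWork m J true p t i = 0
    · simp [h0]
    split_ifs with h h' h'
    · omega
    · omega
    · refine absurd ?_ h
      rw [succ_mem_map_fst_activeJobs] at h' ⊢
      exact ⟨⟨h'.1.1, hr i ▸ h'.1.2.1, h0⟩,
        (sum_snd_le_of_sublist (hsub.filter _)).trans h'.2⟩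
    · exact hi

theorem hatAvail_eq_zero_or {m : ℕ} (v : ℕ → ℕ) (c n : ℕ) :
    hatAvail m v c (n + 1) = 0 ∨ hatAvail m v c (n + 1) = c ∧ ∀ j ≤ n, v j ≤ c := by
  induction n with
  | zero =>
    by_cases hm : m = 0 <;> by_cases h : v 0 ≤ c <;> simp [hatAvail, hm, h]
  | succ n ih =>
    rw [hatAvail]
    split_ifs with h0 h
    · exact Or.inl rfl
    · refine Or.inr ⟨rfl, fun j hj => ?_⟩
      rcases hj.lt_or_eq with hj | rfl
      · exact (ih.resolve_left h0).2 j (Nat.le_of_lt_succ hj)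
      · exact h
    · exact Or.inl rfl

theorem hatAvail_succ_eq {m : ℕ} (hm : m ≠ 0) {v : ℕ → ℕ} {c n : ℕ} (hc : c ≠ 0)
    (h : ∀ j ≤ n, v j ≤ c) : hatAvail m v c (n + 1) = c := by
  induction n with
  | zero => simp [hatAvail, hm, h 0 le_rfl]
  | succ n ih =>
    rw [hatAvail, ih fun j hj => h j (hj.trans n.le_succ), if_neg hc, if_pos (h _ le_rfl)]

/-- If every one of the `p` jobs would fit on the processors left idle by the schedule of the
larger job set, then the smaller one leaves at least as many idle processors. -/
theorem availCount_le {m : ℕ} {J J' : ℕ → Job} (hr : ∀ i, (J' i).r = (J i).r)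
    (hv : ∀ i, (J' i).v = (J i).v) (he : ∀ i, (J i).e ≤ (J' i).e) (hv1 : ∀ i, 1 ≤ (J i).v)
    {p t : ℕ} (hfit : ∀ j < p, (J j).v ≤ availCount m J' true p t) :
    availCount m J' true p t ≤ availCount m J true p t := by
  have hsum := sum_snd_le_of_sublist
    (activeJobs_sublist hr hv p t (remWork_mono (m := m) hr hv he hv1 p t))
  have hid : ∀ (K : ℕ → Job) (rem : ℕ → ℕ), ∀ x ∈ activeJobs K p t rem, x.1 ≠ 0 := by
    intro K rem x hx
    obtain ⟨j, -, -, rfl⟩ := mem_activeJobs.1 hx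
    exact j.succ_ne_zero
  have hle := sum_le_freeCount_of_forall_le (σt := fun _ : Fin m => 0)
    (activeJobs J' p t (remWork m J' true p t)) (hid _ _) (by
      intro x hx
      obtain ⟨j, hj, -, rfl⟩ := mem_activeJobs.1 hx
      rw [hv]
      exact hfit j hj)
  have h' := freeCount_gangPass_add _ (hid _ _) hle
  have h := freeCount_gangPass_add _ (hid J _) (hsum.trans hle)
  change freeCount (schedAt m J' true p t) ≤ freeCount (schedAt m J true p t)
  unfold schedAt
  omega

/-- **Lemma 3 (limited level-`i` availability, Limited Gang FJP).**
Let `J` be an ordered set of jobs (0-indexed, decreasing priorities) with actual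
execution times `eᵢ ≤ eᵢ⁺`, and `J⁺` the corresponding worst-case jobs (same
release times, processor requirements and deadlines). If `J⁺` is schedulable by
the Limited Gang FJP scheduler on `m` identical processors, then
`Â_i(J⁺⁽ⁱ⁻¹⁾, t) ≤ Â_i(J⁽ⁱ⁻¹⁾, t)` for all `t` and all `i` (0-indexed: level
`i + 1` computed from the availability of the schedule of the `i` jobs of higher
priority than job `i`). -/
theorem limited_gang_fjp_level_avail
    (m : ℕ) (J Jplus : ℕ → Job)
    (hr : ∀ i, (Jplus i).r = (J i).r)
    (hv : ∀ i, (Jplus i).v = (J i).v)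
    (hd : ∀ i, (Jplus i).d = (J i).d)
    (he : ∀ i, (J i).e ≤ (Jplus i).e)
    (hv1 : ∀ i, 1 ≤ (J i).v)
    (hsched : ∀ p, Schedulable m Jplus true p) :
    ∀ i t, hatAvail m (fun j => (J j).v) (availCount m Jplus true i t) (i + 1) ≤
      hatAvail m (fun j => (J j).v) (availCount m J true i t) (i + 1) := by
  intro i t
  rcases hatAvail_eq_zero_or (m := m) (fun j => (J j).v) (availCount m Jplus true i t) i
    with h | ⟨h, hfit⟩
  · rw [h]
    exact Nat.zero_le _
  · have hle := availCount_le hr hv he hv1 fun j hj => hfit j hj.le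
    have hpos : 1 ≤ availCount m Jplus true i t := (hv1 i).trans (hfit i le_rfl)
    have hm : m ≠ 0 := by
      rintro rfl
      simp [availCount] at hpos
    rw [h, hatAvail_succ_eq hm (by omega) fun j hj => (hfit j hj).trans hle]
    exact hle
end

section
/- For any preemptive (limited or not) Gang FTP algorithm 𝒜, if an asynchronous constrained-deadline periodic task system τ = {τ₁, …, τ_n} (with each job of τ_i executing for exactly C_i time units) is 𝒜-feasible on m identical processors, then the 𝒜-feasible schedule of τ is periodic with period P := lcm{T₁, …, T_n} from the instant S_n, where S₁ := O₁ and S_i := max{O_i, O_i + ⌈(S_{i−1} − O_i)/T_i⌉·T_i} for i ∈ {2, …, n}; i.e., σ(t) = σ(t + P) for all t ≥ S_n. -/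
/-- A periodic parallel rigid task `τᵢ = (Oᵢ, vᵢ, Cᵢ, Dᵢ, Tᵢ)`: offset, required
number of processors, (worst-case) execution requirement, relative deadline,
period. Its `k`-th job is released at `Oᵢ + k·Tᵢ`, requires `vᵢ` processors
simultaneously and has absolute deadline `Oᵢ + k·Tᵢ + Dᵢ`. -/
structure PTask where
  O : ℕ
  v : ℕ
  C : ℕ
  D : ℕ
  T : ℕ

/-- Remaining execution requirement of the current job of task `i` at (the start
of) slot `t`, *before* a possible release at time `t`, in the Gang FTP schedule of
the tasks `τ₀ > τ₁ > ⋯ > τ_{n-1}` (decreasing fixed task priorities) on `m`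
identical processors; `exec i k` is the actual execution time of the `k`-th job of
task `i`. -/
def taskRemPre (m n : ℕ) (τ : ℕ → PTask) (exec : ℕ → ℕ → ℕ) (limited : Bool) :
    ℕ → ℕ → ℕ
  | 0, _ => 0
  | t + 1, i =>
    let rem : ℕ → ℕ := fun j =>
      if (τ j).O ≤ t ∧ (t - (τ j).O) % (τ j).T = 0 then
        exec j ((t - (τ j).O) / (τ j).T)
      else taskRemPre m n τ exec limited t j
    let σt := gangPass m limited
      (((List.range n).filter fun j => decide (0 < rem j)).map fun j =>
        (j + 1, (τ j).v))
      fun _ => 0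
    if ∃ k : Fin m, σt k = i + 1 then rem i - 1 else rem i

/-- Remaining execution requirement of the current job of task `i` at slot `t`
(after the release occurring at `t`, if any); for the worst-case execution times
`exec i k = Cᵢ`, this is the system state `θ(t)` of task `i`. -/
def taskRem (m n : ℕ) (τ : ℕ → PTask) (exec : ℕ → ℕ → ℕ) (limited : Bool)
    (t i : ℕ) : ℕ :=
  if (τ i).O ≤ t ∧ (t - (τ i).O) % (τ i).T = 0 then
    exec i ((t - (τ i).O) / (τ i).T)
  else taskRemPre m n τ exec limited t i

/-- The schedule `σ(t)` of the task system: `taskSchedAt m n τ exec limited t k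
= i + 1` iff a job of task `τᵢ` occupies processor `π_k` at time `t`, and `= 0`
iff `π_k` is idle. -/
def taskSchedAt (m n : ℕ) (τ : ℕ → PTask) (exec : ℕ → ℕ → ℕ) (limited : Bool)
    (t : ℕ) : Fin m → ℕ :=
  gangPass m limited
    (((List.range n).filter fun j =>
        decide (0 < taskRem m n τ exec limited t j)).map fun j =>
      (j + 1, (τ j).v))
    fun _ => 0

/-- The task system is feasible for the given execution times: every job meets its
deadline, i.e. the `k`-th job of each task `τᵢ` has completed by
`Oᵢ + k·Tᵢ + Dᵢ`. -/
def Feasible (m n : ℕ) (τ : ℕ → PTask) (exec : ℕ → ℕ → ℕ) (limited : Bool) : Prop :=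
  ∀ i < n, ∀ k : ℕ,
    taskRemPre m n τ exec limited ((τ i).O + k * (τ i).T + (τ i).D) i = 0

/-- The instants `Sᵢ` of the periodicity theorem (0-indexed): `S₀ = O₀` and
`Sᵢ = max {Oᵢ, Oᵢ + ⌈(Sᵢ₋₁ - Oᵢ)/Tᵢ⌉·Tᵢ}` (the ceiling taken over the integers;
taking its nonnegative part does not change the value of the `max`). -/
def Sinst (τ : ℕ → PTask) : ℕ → ℕ
  | 0 => (τ 0).O
  | i + 1 =>
    max (τ (i + 1)).O
      ((τ (i + 1)).O +
        (⌈((Sinst τ i : ℚ) - ((τ (i + 1)).O : ℚ)) / ((τ (i + 1)).T : ℚ)⌉).toNat *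
          (τ (i + 1)).T)

/-- `P = lcm {T₁, …, Tₙ}`, the hyperperiod of the task system. -/
def hyperPeriod (τ : ℕ → PTask) (n : ℕ) : ℕ :=
  (Finset.range n).lcm fun i => (τ i).T


theorem gangPass_apply_eq_iff_of_notMem {m : ℕ} {limited : Bool} {x : ℕ} (hx : x ≠ 0)
    (l : List (ℕ × ℕ)) (hl : ∀ p ∈ l, p.1 ≠ x) (σt : Fin m → ℕ) (k : Fin m) :
    gangPass m limited l σt k = x ↔ σt k = x := by
  induction l generalizing σt with
  | nil => rfl
  | cons p l ih =>
    obtain ⟨id, v⟩ := p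
    have hid : id ≠ x := hl (id, v) (by simp)
    have ih := ih fun p hp => hl p (by simp [hp])
    unfold gangPass
    split_ifs with hv
    · rw [ih, assignJob]
      grind
    · rfl
    · exact ih _

theorem gangPass_append_apply_eq_iff {m : ℕ} {limited : Bool} {x : ℕ} (hx : x ≠ 0)
    (l₁ l₂ : List (ℕ × ℕ)) (hl : ∀ p ∈ l₂, p.1 ≠ x) (σt : Fin m → ℕ) (k : Fin m) :
    gangPass m limited (l₁ ++ l₂) σt k = x ↔ gangPass m limited l₁ σt k = x := by
  induction l₁ generalizing σt with
  | nil => exact gangPass_apply_eq_iff_of_notMem hx l₂ hl σt k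
  | cons p l ih =>
    obtain ⟨id, v⟩ := p
    rw [List.cons_append]
    unfold gangPass
    split_ifs
    · exact ih _
    · rfl
    · exact ih _

/-- Whether a task is scheduled depends only on the activity of the tasks of at least its
priority. -/
theorem taskSchedAt_eq_succ_congr {m n : ℕ} {τ : ℕ → PTask} {exec : ℕ → ℕ → ℕ} {limited : Bool}
    {t t' i : ℕ} (hi : i < n)
    (h : ∀ j ≤ i, taskRem m n τ exec limited t j = taskRem m n τ exec limited t' j)
    (k : Fin m) :
    taskSchedAt m n τ exec limited t k = i + 1 ↔
      taskSchedAt m n τ exec limited t' k = i + 1 := by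
  obtain ⟨d, rfl⟩ := Nat.exists_eq_add_of_le (Nat.succ_le_of_lt hi)
  have hfilter : (List.range (i + 1)).filter
        (fun j => decide (0 < taskRem m (i + 1 + d) τ exec limited t j)) =
      (List.range (i + 1)).filter
        (fun j => decide (0 < taskRem m (i + 1 + d) τ exec limited t' j)) :=
    List.filter_congr fun j hj => by rw [h j (by simpa [Nat.lt_succ_iff] using hj)]
  unfold taskSchedAt
  simp only [Nat.succ_eq_add_one, List.range_add (n := i + 1), List.filter_append,
    List.map_append]
  rw [gangPass_append_apply_eq_iff (Nat.add_one_ne_zero i), gangPass_append_apply_eq_iff (Nat.add_one_ne_zero i),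
    hfilter]
  all_goals
    intro p hp
    simp only [List.mem_map, List.mem_filter] at hp
    grind

theorem taskRemPre_succ (m n : ℕ) (τ : ℕ → PTask) (exec : ℕ → ℕ → ℕ) (limited : Bool)
    (t i : ℕ) :
    taskRemPre m n τ exec limited (t + 1) i =
      if ∃ k : Fin m, taskSchedAt m n τ exec limited t k = i + 1 then
        taskRem m n τ exec limited t i - 1
      else taskRem m n τ exec limited t i := by
  rw [taskRemPre]
  rfl

theorem offset_le_Sinst (τ : ℕ → PTask) (i : ℕ) : (τ i).O ≤ Sinst τ i := by
  cases i with
  | zero => exact le_rfl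
  | succ i => exact le_max_left _ _

theorem Sinst_sub_offset_mod_period (τ : ℕ → PTask) (i : ℕ) :
    (Sinst τ i - (τ i).O) % (τ i).T = 0 := by
  cases i with
  | zero => simp [Sinst]
  | succ i => simp [Sinst]

theorem Sinst_le_Sinst_succ (τ : ℕ → PTask) (i : ℕ) (hT : 1 ≤ (τ (i + 1)).T) :
    Sinst τ i ≤ Sinst τ (i + 1) := by
  rw [Sinst]
  refine le_max_of_le_right ?_
  set O := (τ (i + 1)).O
  set T := (τ (i + 1)).T
  set z := ⌈((Sinst τ i : ℚ) - (O : ℚ)) / (T : ℚ)⌉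
  have hT0 : (0 : ℚ) < T := by exact_mod_cast hT
  have hz_toNat : (z : ℚ) ≤ (z.toNat : ℚ) := by exact_mod_cast Int.self_le_toNat z
  have hz : ((Sinst τ i : ℚ) - O) / T ≤ (z.toNat : ℚ) := (Int.le_ceil _).trans hz_toNat
  rw [div_le_iff₀ hT0] at hz
  have : (Sinst τ i : ℚ) ≤ O + z.toNat * T := by linarith
  exact_mod_cast this

theorem release_add_iff {τ : PTask} {P t : ℕ} (hP : τ.T ∣ P) (ht : τ.O ≤ t) :
    (τ.O ≤ t + P ∧ (t + P - τ.O) % τ.T = 0) ↔ (τ.O ≤ t ∧ (t - τ.O) % τ.T = 0) := by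
  obtain ⟨c, rfl⟩ := hP
  rw [Nat.sub_add_comm ht, Nat.add_mul_mod_self_left]
  simp [ht, ht.trans (Nat.le_add_right t _)]

/-- The state of a task repeats from a release on, provided that the states of the tasks of
higher priority do. -/
theorem taskRem_add_eq_of_release {m n : ℕ} {τ : ℕ → PTask} {C : ℕ → ℕ} {limited : Bool}
    {P S i : ℕ} (hi : i < n) (hP : (τ i).T ∣ P) (hO : (τ i).O ≤ S)
    (hS : (S - (τ i).O) % (τ i).T = 0)
    (h : ∀ j < i, ∀ t, S ≤ t → taskRem m n τ (fun i _ => C i) limited t j =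
      taskRem m n τ (fun i _ => C i) limited (t + P) j) :
    ∀ t, S ≤ t → taskRem m n τ (fun i _ => C i) limited t i =
      taskRem m n τ (fun i _ => C i) limited (t + P) i := by
  intro t ht
  induction t, ht using Nat.le_induction with
  | base =>
    rw [taskRem, taskRem, if_pos ⟨hO, hS⟩, if_pos ((release_add_iff hP hO).2 ⟨hO, hS⟩)]
  | succ t ht ih =>
    have hle : ∀ j ≤ i, taskRem m n τ (fun i _ => C i) limited t j =
        taskRem m n τ (fun i _ => C i) limited (t + P) j := fun j hj =>
      (Nat.lt_or_eq_of_le hj).elim (fun hj => h j hj t ht) (fun hj => hj ▸ ih)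
    have hpre : taskRemPre m n τ (fun i _ => C i) limited (t + 1) i =
        taskRemPre m n τ (fun i _ => C i) limited (t + 1 + P) i := by
      rw [Nat.add_right_comm t 1 P, taskRemPre_succ, taskRemPre_succ, ih]
      simp only [taskSchedAt_eq_succ_congr hi hle]
    rw [taskRem, taskRem, hpre]
    simp only [release_add_iff hP (hO.trans (ht.trans t.le_succ))]

theorem taskRem_add_eq_of_Sinst_le {m n : ℕ} {τ : ℕ → PTask} {C : ℕ → ℕ} {limited : Bool}
    {P : ℕ} (hT : ∀ i < n, 1 ≤ (τ i).T) (hP : ∀ i < n, (τ i).T ∣ P) {i : ℕ} (hi : i < n) :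
    ∀ j ≤ i, ∀ t, Sinst τ i ≤ t → taskRem m n τ (fun i _ => C i) limited t j =
      taskRem m n τ (fun i _ => C i) limited (t + P) j := by
  induction i with
  | zero =>
    intro j hj
    obtain rfl := Nat.le_zero.1 hj
    exact taskRem_add_eq_of_release hi (hP 0 hi) (offset_le_Sinst τ 0)
      (Sinst_sub_offset_mod_period τ 0) (by simp)
  | succ i ih =>
    have hlt : ∀ j < i + 1, ∀ t, Sinst τ (i + 1) ≤ t →
        taskRem m n τ (fun i _ => C i) limited t j =
          taskRem m n τ (fun i _ => C i) limited (t + P) j := fun j hj t ht =>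
      ih (Nat.lt_of_succ_lt hi) j (Nat.le_of_lt_succ hj) t
        ((Sinst_le_Sinst_succ τ i (hT _ hi)).trans ht)
    intro j hj
    rcases Nat.lt_or_eq_of_le hj with hj | rfl
    · exact hlt j hj
    · exact taskRem_add_eq_of_release hi (hP _ hi) (offset_le_Sinst τ _)
        (Sinst_sub_offset_mod_period τ _) hlt

/-- **Periodicity theorem.** For any preemptive (limited or not) Gang FTP
algorithm `𝒜`, if an asynchronous constrained-deadline periodic task system
`τ = {τ₀ > τ₁ > ⋯ > τ_{n-1}}` (each job of `τᵢ` executing for exactly `Cᵢ` time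
units, `Dᵢ ≤ Tᵢ`, `Tᵢ ≥ 1`, `vᵢ ≥ 1`) is `𝒜`-feasible on `m` identical
processors, then the `𝒜`-feasible schedule of `τ` is periodic with period
`P = lcm {T₁, …, Tₙ}` from the instant `Sₙ` (here `Sinst τ (n-1)`, 0-indexed),
where `S₁ = O₁` and `Sᵢ = max {Oᵢ, Oᵢ + ⌈(Sᵢ₋₁ - Oᵢ)/Tᵢ⌉·Tᵢ}`:
`σ(t) = σ(t + P)` for all `t ≥ Sₙ`. -/
theorem gang_ftp_schedule_periodicity
    (m n : ℕ) (τ : ℕ → PTask) (limited : Bool)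
    (hn : 1 ≤ n)
    (hD : ∀ i < n, (τ i).D ≤ (τ i).T)
    (hT : ∀ i < n, 1 ≤ (τ i).T)
    (hv1 : ∀ i < n, 1 ≤ (τ i).v)
    (hfeas : Feasible m n τ (fun i _ => (τ i).C) limited) :
    ∀ t, Sinst τ (n - 1) ≤ t →
      taskSchedAt m n τ (fun i _ => (τ i).C) limited t =
        taskSchedAt m n τ (fun i _ => (τ i).C) limited (t + hyperPeriod τ n) := by
  intro t ht
  have hP : ∀ i < n, (τ i).T ∣ hyperPeriod τ n := fun i hi =>
    Finset.dvd_lcm (f := fun i => (τ i).T) (Finset.mem_range.2 hi)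
  unfold taskSchedAt
  congr 2
  refine List.filter_congr fun j hj => ?_
  have hj : j < n := List.mem_range.1 hj
  rw [taskRem_add_eq_of_Sinst_le (C := fun i => (τ i).C) hT hP (Nat.sub_one_lt_of_le hn le_rfl)
    j (Nat.le_sub_one_of_lt hj) t ht]
end
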